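/- arXiv:2402.09317 — 3 statements merged into one kernel-verified Lean document; each statement's English description precedes it below -/
import Mathlib

section
/- Let T>0 and let (x,ξ):[0,T]→ℝ^d×ℝ^l be a càdlàg path with initial value (x(0−),ξ(0−)) such that every component of ξ is non-decreasing and ξ(0−) ≤ ξ(0) componentwise. If the map u ↦ ((x̄_u,ξ̄_u), r̄_u) is a WM1-parametrisation of (x,ξ), then (x̄,ξ̄,r̄) ∈ 𝒟(𝒮) and 𝒮(x̄,ξ̄,r̄) = (x,ξ) (including equality of the initial values). -/
open Set Filter Topology

noncomputable section

/-- The left-limit function `y(t−)` of a path `y` with initial value `y0 = y(0−)`. -/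
def pathMinus {ι : Type*} (y : ℝ → ι → ℝ) (y0 : ι → ℝ) (t : ℝ) : ι → ℝ :=
  if t ≤ 0 then y0 else fun i => Function.leftLim (fun s => y s i) t

/-- The thick graph `G_y` of the path `y` on `[0,T]` with initial value `y0`. -/
def thickGraph {ι : Type*} (T : ℝ) (y : ℝ → ι → ℝ) (y0 : ι → ℝ) : Set ((ι → ℝ) × ℝ) :=
  {p | p.2 ∈ Set.Icc 0 T ∧ ∀ i, p.1 i ∈ Set.uIcc (pathMinus y y0 p.2 i) (y p.2 i)}

/-- The order relation on the thick graph `G_y`. -/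
def graphLE {ι : Type*} (y : ℝ → ι → ℝ) (y0 : ι → ℝ) (p q : (ι → ℝ) × ℝ) : Prop :=
  p.2 < q.2 ∨ (p.2 = q.2 ∧ ∀ i, |pathMinus y y0 p.2 i - p.1 i| ≤ |pathMinus y y0 p.2 i - q.1 i|)

/-- `(yh, rh)` restricted to `[0,1]` is a `WM1`-parametrisation of the path `y` on `[0,T]`
with initial value `y0`. -/
def IsWM1Param {ι : Type*} (T : ℝ) (y : ℝ → ι → ℝ) (y0 : ι → ℝ)
    (yh : ℝ → ι → ℝ) (rh : ℝ → ℝ) : Prop :=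
  ContinuousOn yh (Set.Icc 0 1) ∧ ContinuousOn rh (Set.Icc 0 1) ∧
  (∀ u ∈ Set.Icc (0:ℝ) 1, (yh u, rh u) ∈ thickGraph T y y0) ∧
  (∀ u ∈ Set.Icc (0:ℝ) 1, ∀ v ∈ Set.Icc (0:ℝ) 1, u ≤ v →
    graphLE y y0 (yh u, rh u) (yh v, rh v)) ∧
  yh 0 = y0 ∧ yh 1 = y T ∧ rh 0 = 0 ∧ rh 1 = T

/-- Generalised inverse time change `r_t = inf{v ∈ [0,1] : r̄(v) > t}`, with `inf ∅ = 1`. -/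
def invTime (rb : ℝ → ℝ) (t : ℝ) : ℝ :=
  sInf (insert 1 {v : ℝ | v ∈ Set.Icc (0:ℝ) 1 ∧ t < rb v})

/-- A path is càdlàg on `[0,T]`: right-continuous on `[0,T)` with left limits on `(0,T]`. -/
def IsCadlagOn {E : Type*} [TopologicalSpace E] (T : ℝ) (y : ℝ → E) : Prop :=
  (∀ t ∈ Set.Ico (0:ℝ) T, Tendsto y (𝓝[>] t) (𝓝 (y t))) ∧
  (∀ t ∈ Set.Ioc (0:ℝ) T, ∃ L, Tendsto y (𝓝[<] t) (𝓝 L))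

/-- The domain `𝒟(𝒮)` of the unparametrisation map `𝒮`. -/
def InDomainS (T : ℝ) {d l : ℕ} (xb : ℝ → Fin d → ℝ) (ξb : ℝ → Fin l → ℝ) (rb : ℝ → ℝ) :
    Prop :=
  ContinuousOn xb (Set.Icc 0 1) ∧ ContinuousOn ξb (Set.Icc 0 1) ∧
  ContinuousOn rb (Set.Icc 0 1) ∧
  (∀ i, MonotoneOn (fun u => ξb u i) (Set.Icc 0 1)) ∧ MonotoneOn rb (Set.Icc 0 1) ∧
  (∀ u ∈ Set.Icc (0:ℝ) 1, rb u ∈ Set.Icc 0 T) ∧ rb 0 = 0 ∧ rb 1 = T ∧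
  (∀ a b : ℝ, 0 ≤ a → a ≤ b → b ≤ 1 → (∀ u ∈ Set.Icc a b, rb u = rb a) →
    ∀ i, MonotoneOn (fun u => xb u i) (Set.Icc a b) ∨ AntitoneOn (fun u => xb u i) (Set.Icc a b))

/-- The (combined) path `𝒮(x̄,ξ̄,r̄) = (x̄∘r, ξ̄∘r)` on `[0,T]`. -/
def sPath {d l : ℕ} (xb : ℝ → Fin d → ℝ) (ξb : ℝ → Fin l → ℝ) (rb : ℝ → ℝ) (t : ℝ) :
    (Fin d ⊕ Fin l) → ℝ :=
  Sum.elim (xb (invTime rb t)) (ξb (invTime rb t))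

end

theorem IsCadlagOn.tendsto_pathMinus {ι : Type*} {T : ℝ} {y : ℝ → ι → ℝ}
    (hy : IsCadlagOn T y) (y0 : ι → ℝ) {t : ℝ} (ht : t ∈ Ioc (0 : ℝ) T) (i : ι) :
    Tendsto (fun s => y s i) (𝓝[<] t) (𝓝 (pathMinus y y0 t i)) := by
  obtain ⟨L, hL⟩ := hy.2 t ht
  rw [pathMinus, if_neg ht.1.not_ge]
  exact tendsto_leftLim_of_tendsto ⟨L i, tendsto_pi_nhds.1 hL i⟩

theorem IsCadlagOn.tendsto_pathMinus_nhdsGT {ι : Type*} {T : ℝ} {y : ℝ → ι → ℝ}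
    (hy : IsCadlagOn T y) (y0 : ι → ℝ) {t : ℝ} (ht : t ∈ Ico (0 : ℝ) T) (i : ι) :
    Tendsto (fun s => pathMinus y y0 s i) (𝓝[>] t) (𝓝 (y t i)) := by
  rw [(closed_nhds_basis (y t i)).tendsto_right_iff]
  rintro C ⟨hC, hCclosed⟩
  have hev : ∀ᶠ s in 𝓝[>] t, y s i ∈ C := tendsto_pi_nhds.1 (hy.1 t ht) i hC
  obtain ⟨u, hu, hsub⟩ := mem_nhdsGT_iff_exists_Ioo_subset.1 hev
  filter_upwards [Ioo_mem_nhdsGT (lt_min hu ht.2)] with s hs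
  have hsu : s < u := hs.2.trans_le (min_le_left _ _)
  have hsT : s ≤ T := (hs.2.trans_le (min_le_right _ _)).le
  refine hCclosed.mem_of_tendsto (hy.tendsto_pathMinus y0 ⟨ht.1.trans_lt hs.1, hsT⟩ i) ?_
  filter_upwards [Ioo_mem_nhdsLT hs.1] with r hr
  exact hsub ⟨hr.1, hr.2.trans hsu⟩

section MonotoneComponent

variable {ι : Type*} {T : ℝ} {y : ℝ → ι → ℝ} {y0 : ι → ℝ} {i : ι}

theorem IsCadlagOn.pathMinus_le (hy : IsCadlagOn T y)
    (hmono : MonotoneOn (fun t => y t i) (Icc 0 T)) (h0 : y0 i ≤ y 0 i) {t : ℝ}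
    (ht : t ∈ Icc (0 : ℝ) T) : pathMinus y y0 t i ≤ y t i := by
  rcases ht.1.eq_or_lt with rfl | hpos
  · simpa [pathMinus] using h0
  · refine le_of_tendsto (hy.tendsto_pathMinus y0 ⟨hpos, ht.2⟩ i) ?_
    filter_upwards [Ioo_mem_nhdsLT hpos] with r hr
    exact hmono ⟨hr.1.le, hr.2.le.trans ht.2⟩ ht hr.2.le

theorem IsCadlagOn.le_pathMinus (hy : IsCadlagOn T y)
    (hmono : MonotoneOn (fun t => y t i) (Icc 0 T)) {s t : ℝ}
    (hs : 0 ≤ s) (hst : s < t) (ht : t ≤ T) : y s i ≤ pathMinus y y0 t i := by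
  refine ge_of_tendsto (hy.tendsto_pathMinus y0 ⟨hs.trans_lt hst, ht⟩ i) ?_
  filter_upwards [Ioo_mem_nhdsLT hst] with r hr
  exact hmono ⟨hs, hst.le.trans ht⟩ ⟨hs.trans hr.1.le, hr.2.le.trans ht⟩ hr.1.le

end MonotoneComponent

section InvTime

variable {rb : ℝ → ℝ} {t : ℝ}

theorem bddBelow_invTime_set :
    BddBelow (insert 1 {v : ℝ | v ∈ Icc (0 : ℝ) 1 ∧ t < rb v}) := by
  refine ⟨0, ?_⟩
  rintro v (rfl | hv)
  exacts [zero_le_one, hv.1.1]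

theorem invTime_mem_Icc : invTime rb t ∈ Icc (0 : ℝ) 1 := by
  refine ⟨le_csInf (insert_nonempty _ _) ?_, csInf_le bddBelow_invTime_set (mem_insert _ _)⟩
  rintro v (rfl | hv)
  exacts [zero_le_one, hv.1.1]

theorem invTime_eq_one (h : ∀ v ∈ Icc (0 : ℝ) 1, rb v ≤ t) : invTime rb t = 1 := by
  have : {v : ℝ | v ∈ Icc (0 : ℝ) 1 ∧ t < rb v} = ∅ :=
    eq_empty_of_forall_notMem fun v hv => (h v hv.1).not_gt hv.2
  rw [invTime, this, insert_empty_eq, csInf_singleton]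

theorem le_of_lt_invTime {v : ℝ} (hv : 0 ≤ v) (h : v < invTime rb t) : rb v ≤ t := by
  by_contra! hlt
  exact h.not_ge (csInf_le bddBelow_invTime_set
    (mem_insert_of_mem _ ⟨⟨hv, h.le.trans invTime_mem_Icc.2⟩, hlt⟩))

theorem lt_of_invTime_lt (hmono : MonotoneOn rb (Icc 0 1)) {v : ℝ} (hv : v ≤ 1)
    (h : invTime rb t < v) : t < rb v := by
  obtain ⟨w, hw, hwv⟩ := exists_lt_of_csInf_lt (insert_nonempty _ _) h
  rcases hw with rfl | hw
  · exact absurd hwv hv.not_gt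
  · exact hw.2.trans_le (hmono hw.1 ⟨hw.1.1.trans hwv.le, hv⟩ hwv.le)

theorem apply_invTime_le (hcont : ContinuousOn rb (Icc 0 1)) (h0 : rb 0 ≤ t) :
    rb (invTime rb t) ≤ t := by
  rcases (invTime_mem_Icc (rb := rb) (t := t)).1.eq_or_lt with h | hpos
  · rwa [← h]
  · have hev : ∀ᶠ v in 𝓝[<] invTime rb t, v ∈ Ioo 0 (invTime rb t) := Ioo_mem_nhdsLT hpos
    have hle : 𝓝[<] invTime rb t ≤ 𝓝[Icc 0 1] invTime rb t :=
      nhdsWithin_le_of_mem <| hev.mono fun v hv => ⟨hv.1.le, hv.2.le.trans invTime_mem_Icc.2⟩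
    exact le_of_tendsto ((hcont _ invTime_mem_Icc).mono_left hle)
      (hev.mono fun v hv => le_of_lt_invTime hv.1.le hv.2)

theorem nhdsGT_invTime_le (hlt : invTime rb t < 1) :
    𝓝[>] invTime rb t ≤ 𝓝[Icc 0 1] invTime rb t :=
  nhdsWithin_le_of_mem <| mem_of_superset (Ioo_mem_nhdsGT hlt) fun _ hv =>
    ⟨invTime_mem_Icc.1.trans hv.1.le, hv.2.le⟩

theorem tendsto_invTime_nhdsGT (hcont : ContinuousOn rb (Icc 0 1))
    (hmono : MonotoneOn rb (Icc 0 1)) (h0 : rb 0 ≤ t) (hlt : invTime rb t < 1) :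
    Tendsto rb (𝓝[>] invTime rb t) (𝓝[>] t) := by
  have hlim := (hcont _ invTime_mem_Icc).mono_left (nhdsGT_invTime_le hlt)
  have hev : ∀ᶠ v in 𝓝[>] invTime rb t, t < rb v :=
    mem_of_superset (Ioo_mem_nhdsGT hlt) fun v hv => lt_of_invTime_lt hmono hv.2.le hv.1
  have heq : rb (invTime rb t) = t :=
    (apply_invTime_le hcont h0).antisymm (ge_of_tendsto hlim (hev.mono fun _ h => h.le))
  rw [heq] at hlim
  exact tendsto_nhdsWithin_iff.2 ⟨hlim, hev⟩

end InvTime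

namespace IsWM1Param

variable {ι : Type*} {T : ℝ} {y : ℝ → ι → ℝ} {y0 : ι → ℝ} {yh : ℝ → ι → ℝ} {rh : ℝ → ℝ}

theorem monotoneOn_time (h : IsWM1Param T y y0 yh rh) : MonotoneOn rh (Icc 0 1) := by
  intro u hu v hv huv
  rcases h.2.2.2.1 u hu v hv huv with hlt | ⟨heq, -⟩
  exacts [hlt.le, heq.le]

theorem apply_invTime (h : IsWM1Param T y y0 yh rh) (hy : IsCadlagOn T y) {t : ℝ}
    (ht : t ∈ Icc (0 : ℝ) T) : yh (invTime rh t) = y t := by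
  have hrmono := h.monotoneOn_time
  obtain ⟨hyc, hrc, hmem, -, -, hy1, hr0, hr1⟩ := h
  rcases ht.2.eq_or_lt with rfl | htT
  · rw [invTime_eq_one fun v hv => (hmem v hv).1.2, hy1]
  have h0 : rh 0 ≤ t := hr0.le.trans ht.1
  have hlt : invTime rh t < 1 := by
    refine invTime_mem_Icc.2.lt_of_ne fun h1 => ?_
    have := apply_invTime_le hrc h0
    rw [h1, hr1] at this
    exact this.not_gt htT
  have hr := tendsto_invTime_nhdsGT hrc hrmono h0 hlt
  have hle := nhdsGT_invTime_le hlt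
  ext i
  have hlim : Tendsto (fun v => yh v i) (𝓝[>] invTime rh t) (𝓝 (yh (invTime rh t) i)) :=
    tendsto_pi_nhds.1 ((hyc _ invTime_mem_Icc).mono_left hle) i
  have hminus := (hy.tendsto_pathMinus_nhdsGT y0 ⟨ht.1, htT⟩ i).comp hr
  have hright := (tendsto_pi_nhds.1 (hy.1 t ⟨ht.1, htT⟩) i).comp hr
  have hbd : ∀ᶠ v in 𝓝[>] invTime rh t, yh v i ∈ uIcc (pathMinus y y0 (rh v) i) (y (rh v) i) :=
    hle (mem_of_superset self_mem_nhdsWithin fun v hv => (hmem v hv).2 i)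
  have hinf := hminus.min hright
  have hsup := hminus.max hright
  rw [min_self] at hinf
  rw [max_self] at hsup
  exact tendsto_nhds_unique hlim (tendsto_of_tendsto_of_tendsto_of_le_of_le' hinf hsup
    (hbd.mono fun _ hv => hv.1) (hbd.mono fun _ hv => hv.2))

theorem monotoneOn_component (h : IsWM1Param T y y0 yh rh) (hy : IsCadlagOn T y) {i : ι}
    (hmono : MonotoneOn (fun t => y t i) (Icc 0 T)) (h0 : y0 i ≤ y 0 i) :
    MonotoneOn (fun u => yh u i) (Icc 0 1) := by
  obtain ⟨-, -, hmem, hord, -⟩ := h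
  have key : ∀ u ∈ Icc (0 : ℝ) 1, yh u i ∈ Icc (pathMinus y y0 (rh u) i) (y (rh u) i) := by
    intro u hu
    rw [← uIcc_of_le (hy.pathMinus_le hmono h0 (hmem u hu).1)]
    exact (hmem u hu).2 i
  intro u hu v hv huv
  rcases hord u hu v hv huv with hlt | ⟨heq, habs⟩
  · exact (key u hu).2.trans
      ((hy.le_pathMinus hmono (hmem u hu).1.1 hlt (hmem v hv).1.2).trans (key v hv).1)
  · have hu1 := (key u hu).1
    have hv1 := (key v hv).1
    have := habs i
    simp only at heq this
    rw [← heq] at hv1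
    rw [abs_of_nonpos (by linarith), abs_of_nonpos (by linarith)] at this
    change yh u i ≤ yh v i
    linarith

theorem monotoneOn_or_antitoneOn (h : IsWM1Param T y y0 yh rh) {a b : ℝ} (ha : 0 ≤ a)
    (hb : b ≤ 1) (hconst : ∀ u ∈ Icc a b, rh u = rh a) (i : ι) :
    MonotoneOn (fun u => yh u i) (Icc a b) ∨ AntitoneOn (fun u => yh u i) (Icc a b) := by
  obtain ⟨-, -, hmem, hord, -⟩ := h
  have hI : ∀ u ∈ Icc a b, u ∈ Icc (0 : ℝ) 1 := fun u hu => ⟨ha.trans hu.1, hu.2.trans hb⟩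
  have hbd : ∀ u ∈ Icc a b, yh u i ∈ uIcc (pathMinus y y0 (rh a) i) (y (rh a) i) := by
    intro u hu
    rw [← hconst u hu]
    exact (hmem u (hI u hu)).2 i
  have habs : ∀ u ∈ Icc a b, ∀ v ∈ Icc a b, u ≤ v →
      |pathMinus y y0 (rh a) i - yh u i| ≤ |pathMinus y y0 (rh a) i - yh v i| := by
    intro u hu v hv huv
    rcases hord u (hI u hu) v (hI v hv) huv with hlt | ⟨-, h⟩
    · exact absurd hlt (by simp [hconst u hu, hconst v hv])
    · simpa only [hconst u hu] using h i
  rcases le_total (pathMinus y y0 (rh a) i) (y (rh a) i) with hle | hle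
  · left
    intro u hu v hv huv
    have h1 := hbd u hu
    have h2 := hbd v hv
    have h3 := habs u hu v hv huv
    rw [uIcc_of_le hle] at h1 h2
    rw [abs_of_nonpos (sub_nonpos.2 h1.1), abs_of_nonpos (sub_nonpos.2 h2.1)] at h3
    change yh u i ≤ yh v i
    linarith
  · right
    intro u hu v hv huv
    have h1 := hbd u hu
    have h2 := hbd v hv
    have h3 := habs u hu v hv huv
    rw [uIcc_of_ge hle] at h1 h2
    rw [abs_of_nonneg (sub_nonneg.2 h1.2), abs_of_nonneg (sub_nonneg.2 h2.2)] at h3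
    change yh v i ≤ yh u i
    linarith

end IsWM1Param

/-- if `(x,ξ)` is a càdlàg path on `[0,T]` with initial value `(x₀,ξ₀)`,
every component of `ξ` is non-decreasing and `ξ₀ ≤ ξ(0)`, then every `WM1`-parametrisation
`u ↦ ((x̄_u,ξ̄_u), r̄_u)` of `(x,ξ)` lies in `𝒟(𝒮)` and satisfies `𝒮(x̄,ξ̄,r̄) = (x,ξ)`
(including equality of initial values). -/
theorem stmt1 (T : ℝ) (hT : 0 < T) (d l : ℕ)
    (x : ℝ → Fin d → ℝ) (ξ : ℝ → Fin l → ℝ) (x0 : Fin d → ℝ) (ξ0 : Fin l → ℝ)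
    (hcadlag : IsCadlagOn T (fun t => (Sum.elim (x t) (ξ t) : (Fin d ⊕ Fin l) → ℝ)))
    (hmono : ∀ i, MonotoneOn (fun t => ξ t i) (Set.Icc 0 T))
    (hjump0 : ξ0 ≤ ξ 0)
    (xb : ℝ → Fin d → ℝ) (ξb : ℝ → Fin l → ℝ) (rb : ℝ → ℝ)
    (hparam : IsWM1Param T (fun t => Sum.elim (x t) (ξ t)) (Sum.elim x0 ξ0)
      (fun u => Sum.elim (xb u) (ξb u)) rb) :
    InDomainS T xb ξb rb ∧
    (∀ t ∈ Set.Icc (0:ℝ) T, xb (invTime rb t) = x t ∧ ξb (invTime rb t) = ξ t) ∧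
    xb 0 = x0 ∧ ξb 0 = ξ0 := by
  have hmonoR : ∀ j : Fin l, MonotoneOn (fun u => ξb u j) (Icc 0 1) := fun j =>
    hparam.monotoneOn_component hcadlag (i := Sum.inr j) (hmono j) (hjump0 j)
  have hanti := fun (a b : ℝ) (ha : 0 ≤ a) (_ : a ≤ b) (hb : b ≤ 1)
      (hc : ∀ u ∈ Icc a b, rb u = rb a) (j : Fin d) =>
    hparam.monotoneOn_or_antitoneOn ha hb hc (Sum.inl j)
  have hinv := fun (t : ℝ) (ht : t ∈ Icc (0 : ℝ) T) => hparam.apply_invTime hcadlag ht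
  have hrmono := hparam.monotoneOn_time
  obtain ⟨hyc, hrc, hmem, -, hy0, -, hr0, hr1⟩ := hparam
  have hyc' := continuousOn_pi.1 hyc
  refine ⟨⟨continuousOn_pi.2 fun j => hyc' (Sum.inl j), continuousOn_pi.2 fun j => hyc' (Sum.inr j),
    hrc, hmonoR, hrmono, fun u hu => (hmem u hu).1, hr0, hr1, hanti⟩, fun t ht => ?_, ?_⟩
  · exact Sum.elim_eq_iff.1 (hinv t ht)
  · exact Sum.elim_eq_iff.1 hy0
end

section
/- The map 𝒮 is Lipschitz continuous with constant 1 on its domain: for all (x̄,ξ̄,r̄), (ȳ,ζ̄,s̄) ∈ 𝒟(𝒮) it holds that d_{WM1}(𝒮(x̄,ξ̄,r̄), 𝒮(ȳ,ζ̄,s̄)) ≤ max( sup_{u∈[0,1]} |(x̄_u,ξ̄_u) − (ȳ_u,ζ̄_u)|, sup_{u∈[0,1]} |r̄_u − s̄_u| ), where |·| denotes the Euclidean norm. -/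
open Set Filter Topology

noncomputable section

/-- Euclidean distance on `ι → ℝ`. -/
def eucDist {ι : Type*} [Fintype ι] (a b : ι → ℝ) : ℝ :=
  Real.sqrt (∑ i, (a i - b i) ^ 2)

/-- The `WM1` distance between two càdlàg paths on `[0,T]` (with initial values):
the infimum over all pairs of `WM1`-parametrisations of
`max(‖ŷ−ẑ‖_∞, ‖r̂−ŝ‖_∞)`. -/
def dWM1 {ι : Type*} [Fintype ι] (T : ℝ) (y : ℝ → ι → ℝ) (y0 : ι → ℝ)
    (z : ℝ → ι → ℝ) (z0 : ι → ℝ) : ℝ :=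
  sInf {c : ℝ | ∃ yh rh zh sh, IsWM1Param T y y0 yh rh ∧ IsWM1Param T z z0 zh sh ∧
    c = max (⨆ u : Set.Icc (0:ℝ) 1, eucDist (yh u.1) (zh u.1))
      (⨆ u : Set.Icc (0:ℝ) 1, |rh u.1 - sh u.1|)}

end

theorem invTime_mem_Icc_s2 (r : ℝ → ℝ) (t : ℝ) : invTime r t ∈ Set.Icc (0:ℝ) 1 := by
  have hb : ∀ v ∈ insert 1 {v : ℝ | v ∈ Set.Icc (0:ℝ) 1 ∧ t < r v}, (0:ℝ) ≤ v := by
    rintro v (rfl | hv)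
    · exact zero_le_one
    · exact hv.1.1
  exact ⟨le_csInf (insert_nonempty _ _) hb, csInf_le ⟨0, hb⟩ (mem_insert _ _)⟩

theorem invTime_le {r : ℝ → ℝ} {t u : ℝ} (hu : u ∈ Set.Icc (0:ℝ) 1) (h : t < r u) :
    invTime r t ≤ u := by
  refine csInf_le ⟨0, ?_⟩ (mem_insert_of_mem _ ⟨hu, h⟩)
  rintro v (rfl | hv)
  · exact zero_le_one
  · exact hv.1.1

theorem le_invTime {r : ℝ → ℝ} (hr : MonotoneOn r (Set.Icc 0 1)) {t u : ℝ}
    (hu : u ∈ Set.Icc (0:ℝ) 1) (h : r u ≤ t) : u ≤ invTime r t := by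
  refine le_csInf (insert_nonempty _ _) ?_
  rintro v (rfl | hv)
  · exact hu.2
  · by_contra! hvu
    exact absurd (hr hv.1 hu hvu.le) (not_le.mpr (h.trans_lt hv.2))

/-- For a continuous time change, `invTime r t` is the last time at which `r ≤ t`. -/
theorem apply_invTime_le_s2 {r : ℝ → ℝ} (hc : ContinuousOn r (Set.Icc 0 1))
    (hr : MonotoneOn r (Set.Icc 0 1)) {t : ℝ} (h0 : r 0 ≤ t) : r (invTime r t) ≤ t := by
  have hcomp : IsCompact (Set.Icc (0:ℝ) 1 ∩ r ⁻¹' Set.Iic t) :=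
    isCompact_Icc.of_isClosed_subset (hc.preimage_isClosed_of_isClosed isClosed_Icc isClosed_Iic)
      inter_subset_left
  obtain ⟨m, ⟨hm, hmt⟩, hmax⟩ := hcomp.exists_isGreatest ⟨0, by simp, h0⟩
  have heq : invTime r t = m := by
    refine le_antisymm ?_ (le_invTime hr hm hmt)
    by_contra! hlt
    have hmem := invTime_mem_Icc_s2 r t
    obtain ⟨v, hmv, hvb⟩ := exists_between hlt
    have hv : v ∈ Set.Icc (0:ℝ) 1 := ⟨hm.1.trans hmv.le, hvb.le.trans hmem.2⟩
    rcases le_or_gt (r v) t with h | h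
    · exact absurd (hmax ⟨hv, h⟩) (not_le.mpr hmv)
    · exact absurd (invTime_le hv h) (not_le.mpr hvb)
  rw [heq]
  exact hmt

/-- From the left, the generalised inverse converges to the first hitting time. -/
theorem tendsto_invTime_nhdsLT {r : ℝ → ℝ} (hr : MonotoneOn r (Set.Icc 0 1)) {t a : ℝ}
    (h0 : r 0 < t) (ha : IsLeast (Set.Icc (0:ℝ) 1 ∩ r ⁻¹' Set.Ici t) a) :
    Tendsto (invTime r) (𝓝[<] t) (𝓝 a) := by
  obtain ⟨⟨haI, hta⟩, hmin⟩ := ha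
  have hta : t ≤ r a := hta
  have ha0 : 0 < a := by
    rcases haI.1.eq_or_lt with h | h
    · rw [← h] at hta
      exact absurd hta (not_le.mpr h0)
    · exact h
  refine tendsto_order.2 ⟨fun c hc => ?_, fun c hc => ?_⟩
  · obtain ⟨v, hv1, hv2⟩ := exists_between (max_lt hc ha0)
    have hv : v ∈ Set.Icc (0:ℝ) 1 := ⟨(le_max_right _ _).trans hv1.le, hv2.le.trans haI.2⟩
    have hvt : r v < t := by
      by_contra! h
      exact absurd (hmin ⟨hv, h⟩) (not_le.mpr hv2)
    filter_upwards [Ioo_mem_nhdsLT hvt] with s hs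
    exact ((le_max_left _ _).trans_lt hv1).trans_le (le_invTime hr hv hs.1.le)
  · filter_upwards [self_mem_nhdsWithin] with s hs
    exact (invTime_le haI (lt_of_lt_of_le hs hta)).trans_lt hc

/-- The left limit of an unparametrised path is its value at the first hitting time. -/
theorem exists_isLeast_pathMinus_eq {ι : Type*} {T : ℝ} {X : ℝ → ι → ℝ} {r : ℝ → ℝ}
    (hX : ContinuousOn X (Set.Icc 0 1)) (hc : ContinuousOn r (Set.Icc 0 1))
    (hr : MonotoneOn r (Set.Icc 0 1)) (h0 : r 0 = 0) (h1 : r 1 = T) {t : ℝ}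
    (ht : t ∈ Set.Icc 0 T) :
    ∃ a, IsLeast (Set.Icc (0:ℝ) 1 ∩ r ⁻¹' Set.Ici t) a ∧
      pathMinus (fun s => X (invTime r s)) (X 0) t = X a := by
  rcases ht.1.eq_or_lt with rfl | hpos
  · exact ⟨0, ⟨⟨by simp, h0.ge⟩, fun v hv => hv.1.1⟩, by simp [pathMinus]⟩
  have hcomp : IsCompact (Set.Icc (0:ℝ) 1 ∩ r ⁻¹' Set.Ici t) :=
    isCompact_Icc.of_isClosed_subset (hc.preimage_isClosed_of_isClosed isClosed_Icc isClosed_Ici)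
      inter_subset_left
  obtain ⟨a, ha⟩ := hcomp.exists_isLeast ⟨1, by simp, ht.2.trans h1.ge⟩
  refine ⟨a, ha, ?_⟩
  have hlim : Tendsto (fun s => X (invTime r s)) (𝓝[<] t) (𝓝 (X a)) :=
    (hX a ha.1.1).tendsto.comp (tendsto_nhdsWithin_iff.2
      ⟨tendsto_invTime_nhdsLT hr (h0.trans_lt hpos) ha,
        Eventually.of_forall fun s => invTime_mem_Icc_s2 r s⟩)
  funext i
  simp only [pathMinus, if_neg (not_le.mpr hpos)]
  exact leftLim_eq_of_tendsto (tendsto_pi_nhds.1 hlim i)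

/-- A continuous parametrised path that is componentwise monotone on the flat pieces of its
time change is a `WM1`-parametrisation of its unparametrisation. -/
theorem isWM1Param_comp_invTime {ι : Type*} {T : ℝ} {X : ℝ → ι → ℝ} {r : ℝ → ℝ}
    (hX : ContinuousOn X (Set.Icc 0 1)) (hc : ContinuousOn r (Set.Icc 0 1))
    (hr : MonotoneOn r (Set.Icc 0 1)) (h0 : r 0 = 0) (h1 : r 1 = T)
    (hmono : ∀ a b : ℝ, 0 ≤ a → a ≤ b → b ≤ 1 → (∀ u ∈ Set.Icc a b, r u = r a) →
      ∀ i, MonotoneOn (fun u => X u i) (Set.Icc a b) ∨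
        AntitoneOn (fun u => X u i) (Set.Icc a b)) :
    IsWM1Param T (fun t => X (invTime r t)) (X 0) X r := by
  have h01 : (0:ℝ) ∈ Set.Icc (0:ℝ) 1 := by simp
  have h11 : (1:ℝ) ∈ Set.Icc (0:ℝ) 1 := by simp
  have hrange : ∀ u ∈ Set.Icc (0:ℝ) 1, r u ∈ Set.Icc 0 T := fun u hu =>
    ⟨h0 ▸ hr h01 hu hu.1, h1 ▸ hr hu h11 hu.2⟩
  have hflat : ∀ u ∈ Set.Icc (0:ℝ) 1, ∃ a b,
      pathMinus (fun s => X (invTime r s)) (X 0) (r u) = X a ∧ invTime r (r u) = b ∧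
      (∀ v ∈ Set.Icc (0:ℝ) 1, r v = r u → v ∈ Set.Icc a b) ∧
      ∀ i, MonotoneOn (fun u => X u i) (Set.Icc a b) ∨
        AntitoneOn (fun u => X u i) (Set.Icc a b) := by
    intro u hu
    obtain ⟨a, ⟨⟨haI, hua⟩, hmin⟩, heq⟩ :=
      exists_isLeast_pathMinus_eq hX hc hr h0 h1 (hrange u hu)
    have hb := invTime_mem_Icc_s2 r (r u)
    have hbr : r (invTime r (r u)) ≤ r u := apply_invTime_le_s2 hc hr (hr h01 hu hu.1)
    have hmem : ∀ v ∈ Set.Icc (0:ℝ) 1, r v = r u → v ∈ Set.Icc a (invTime r (r u)) :=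
      fun v hv hvu => ⟨hmin ⟨hv, hvu.ge⟩, le_invTime hr hv hvu.le⟩
    have hu' := hmem u hu rfl
    refine ⟨a, _, heq, rfl, hmem, hmono a _ haI.1 (hu'.1.trans hu'.2) hb.2 ?_⟩
    have hconst : ∀ v ∈ Set.Icc a (invTime r (r u)), r v = r u := fun v hv =>
      have hv' : v ∈ Set.Icc (0:ℝ) 1 := ⟨haI.1.trans hv.1, hv.2.trans hb.2⟩
      le_antisymm ((hr hv' hb hv.2).trans hbr) (le_trans hua (hr haI hv' hv.1))
    intro v hv
    rw [hconst v hv, hconst a ⟨le_rfl, hu'.1.trans hu'.2⟩]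
  refine ⟨hX, hc, fun u hu => ⟨hrange u hu, fun i => ?_⟩, fun u hu v hv huv => ?_, rfl, ?_, h0, h1⟩
  · obtain ⟨a, b, heq, hb, hmem, hm⟩ := hflat u hu
    have hu' := hmem u hu rfl
    have hab := hu'.1.trans hu'.2
    simp only [heq, hb]
    rcases hm i with hm | hm
    · exact mem_uIcc.2 (Or.inl ⟨hm ⟨le_rfl, hab⟩ hu' hu'.1, hm hu' ⟨hab, le_rfl⟩ hu'.2⟩)
    · exact mem_uIcc.2 (Or.inr ⟨hm hu' ⟨hab, le_rfl⟩ hu'.2, hm ⟨le_rfl, hab⟩ hu' hu'.1⟩)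
  · rcases (hr hu hv huv).lt_or_eq with h | h
    · exact Or.inl h
    refine Or.inr ⟨h, fun i => ?_⟩
    obtain ⟨a, b, heq, -, hmem, hm⟩ := hflat u hu
    have hu' := hmem u hu rfl
    have hv' := hmem v hv h.symm
    have ha' : a ∈ Set.Icc a b := ⟨le_rfl, hu'.1.trans hu'.2⟩
    simp only [heq]
    rcases hm i with hm | hm
    · have h1 : X a i ≤ X u i := hm ha' hu' hu'.1
      have h2 : X u i ≤ X v i := hm hu' hv' huv
      rw [abs_sub_comm, abs_sub_comm (X a i), abs_of_nonneg (by linarith),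
        abs_of_nonneg (by linarith)]
      linarith
    · have h1 : X u i ≤ X a i := hm ha' hu' hu'.1
      have h2 : X v i ≤ X u i := hm hu' hv' huv
      rw [abs_of_nonneg (by linarith), abs_of_nonneg (by linarith)]
      linarith
  · have : invTime r T = 1 :=
      le_antisymm (invTime_mem_Icc_s2 r T).2 (le_invTime hr h11 h1.le)
    simp only [this]

theorem InDomainS.isWM1Param {T : ℝ} {d l : ℕ} {xb : ℝ → Fin d → ℝ} {ξb : ℝ → Fin l → ℝ}
    {rb : ℝ → ℝ} (h : InDomainS T xb ξb rb) :
    IsWM1Param T (sPath xb ξb rb) (Sum.elim (xb 0) (ξb 0))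
      (fun u => Sum.elim (xb u) (ξb u)) rb := by
  obtain ⟨hx, hξ, hc, hξm, hr, -, h0, h1, hm⟩ := h
  refine isWM1Param_comp_invTime (X := fun u => Sum.elim (xb u) (ξb u)) ?_ hc hr h0 h1 ?_
  · refine continuousOn_pi.2 ?_
    rintro (i | i)
    · exact continuousOn_pi.1 hx i
    · exact continuousOn_pi.1 hξ i
  · rintro a b ha hab hb hconst (i | i)
    · exact hm a b ha hab hb hconst i
    · exact Or.inl ((hξm i).mono (Set.Icc_subset_Icc ha hb))

/-- the unparametrisation map `𝒮` is 1-Lipschitz from the uniform distance on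
parametrised paths to the `WM1` distance. -/
theorem stmt2 (T : ℝ) (hT : 0 < T) (d l : ℕ)
    (xb : ℝ → Fin d → ℝ) (ξb : ℝ → Fin l → ℝ) (rb : ℝ → ℝ)
    (yb : ℝ → Fin d → ℝ) (ζb : ℝ → Fin l → ℝ) (sb : ℝ → ℝ)
    (h1 : InDomainS T xb ξb rb) (h2 : InDomainS T yb ζb sb) :
    dWM1 T (sPath xb ξb rb) (Sum.elim (xb 0) (ξb 0))
        (sPath yb ζb sb) (Sum.elim (yb 0) (ζb 0)) ≤
      max (⨆ u : Set.Icc (0:ℝ) 1, eucDist (Sum.elim (xb u.1) (ξb u.1)) (Sum.elim (yb u.1) (ζb u.1)))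
        (⨆ u : Set.Icc (0:ℝ) 1, |rb u.1 - sb u.1|) := by
  refine csInf_le ⟨0, ?_⟩ ⟨_, _, _, _, h1.isWM1Param, h2.isWM1Param, rfl⟩
  rintro c ⟨yh, rh, zh, sh, -, -, rfl⟩
  exact le_max_of_le_right (Real.iSup_nonneg fun u => abs_nonneg _)
end

section
/- Let g^n, g:[0,1]→ℝ be continuous with g^n → g uniformly on [0,1], and let z^n, z:[0,1]→ℝ be continuous and non-decreasing with z^n → z uniformly on [0,1]. Then sup_{u∈[0,1]} | ∫₀^u g^n dz^n − ∫₀^u g dz | → 0 as n→∞. -/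
open Set Filter MeasureTheory Topology

/-- `μ` is the Lebesgue–Stieltjes measure on `[0,1]` of the (continuous, non-decreasing)
function `z`. -/
def IsLSMeasureOn01 (z : ℝ → ℝ) (μ : Measure ℝ) : Prop :=
  (∀ a b : ℝ, 0 ≤ a → a ≤ b → b ≤ 1 → μ (Set.Icc a b) = ENNReal.ofReal (z b - z a)) ∧
  μ (Set.Icc (0:ℝ) 1)ᶜ = 0

/-- A Lebesgue–Stieltjes measure on `[0,1]` is finite. -/
theorem IsLSMeasureOn01.isFiniteMeasure {z : ℝ → ℝ} {μ : Measure ℝ} (hμ : IsLSMeasureOn01 z μ) :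
    IsFiniteMeasure μ := by
  refine ⟨?_⟩
  rw [← union_compl_self (Icc (0:ℝ) 1)]
  refine (measure_union_le _ _).trans_lt ?_
  rw [hμ.2, hμ.1 0 1 le_rfl zero_le_one le_rfl, add_zero]
  exact ENNReal.ofReal_lt_top

/-- A Lebesgue–Stieltjes measure on `[0,1]` has no atoms there. -/
theorem IsLSMeasureOn01.measure_singleton {z : ℝ → ℝ} {μ : Measure ℝ}
    (hμ : IsLSMeasureOn01 z μ) {a : ℝ} (ha0 : 0 ≤ a) (ha1 : a ≤ 1) : μ {a} = 0 := by
  rw [← Icc_self, hμ.1 a a ha0 le_rfl ha1, sub_self, ENNReal.ofReal_zero]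

/-- The increment of `u ↦ ∫₀ᵘ h dz` over `[a,b]` is within `ε (z b - z a)` of `c (z b - z a)`
as soon as `h` is within `ε` of `c` on `[a,b]`. -/
theorem IsLSMeasureOn01.abs_integral_increment_sub_le {z h : ℝ → ℝ} {μ : Measure ℝ}
    (hμ : IsLSMeasureOn01 z μ) (hz : MonotoneOn z (Icc 0 1)) (hh : ContinuousOn h (Icc 0 1))
    {a b c ε : ℝ} (ha : 0 ≤ a) (hab : a ≤ b) (hb : b ≤ 1)
    (hc : ∀ x ∈ Icc a b, |h x - c| ≤ ε) :
    |(∫ v in Icc 0 b, h v ∂μ) - (∫ v in Icc 0 a, h v ∂μ) - c * (z b - z a)|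
      ≤ ε * (z b - z a) := by
  have := hμ.isFiniteMeasure
  have hh01 : IntegrableOn h (Icc 0 1) μ := hh.integrableOn_compact isCompact_Icc
  have hzab : 0 ≤ z b - z a :=
    sub_nonneg.2 (hz ⟨ha, hab.trans hb⟩ ⟨ha.trans hab, hb⟩ hab)
  have hreal : μ.real (Icc a b) = z b - z a := by
    rw [measureReal_def, hμ.1 a b ha hab hb, ENNReal.toReal_ofReal hzab]
  have hhab : IntegrableOn h (Icc a b) μ := hh01.mono_set (Icc_subset_Icc ha hb)
  have hsplit : ∫ v in Icc 0 b, h v ∂μ = (∫ v in Icc 0 a, h v ∂μ) + ∫ v in Icc a b, h v ∂μ := by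
    rw [← Icc_union_Ioc_eq_Icc ha hab, setIntegral_union, ← setIntegral_congr_set
      (Ioc_ae_eq_Icc' (hμ.measure_singleton ha (hab.trans hb)))]
    · exact Set.disjoint_left.2 fun x hx hx' => not_lt.2 hx.2 hx'.1
    · exact measurableSet_Ioc
    · exact hh01.mono_set (Icc_subset_Icc le_rfl (hab.trans hb))
    · exact hhab.mono_set Ioc_subset_Icc_self
  have hsub : ∫ v in Icc a b, (h v - c) ∂μ = (∫ v in Icc a b, h v ∂μ) - c * (z b - z a) := by
    rw [integral_sub hhab (integrable_const c), setIntegral_const, hreal, smul_eq_mul, mul_comm c]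
  rw [hsplit, add_sub_cancel_left, ← hsub, ← hreal]
  exact norm_setIntegral_le_of_norm_le_const (f := fun v => h v - c) (measure_lt_top _ _) hc

/-- Comparison of two Stieltjes integrals along the uniform partition of `[0,u]` into `N` cells. -/
theorem IsLSMeasureOn01.abs_integral_sub_integral_le {z₁ z₂ h₁ h₂ : ℝ → ℝ} {μ₁ μ₂ : Measure ℝ}
    (hμ₁ : IsLSMeasureOn01 z₁ μ₁) (hμ₂ : IsLSMeasureOn01 z₂ μ₂)
    (hz₁ : MonotoneOn z₁ (Icc 0 1)) (hz₂ : MonotoneOn z₂ (Icc 0 1))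
    (hh₁ : ContinuousOn h₁ (Icc 0 1)) (hh₂ : ContinuousOn h₂ (Icc 0 1))
    {ε δ M : ℝ} {N : ℕ} (hN : 0 < N)
    (hM : ∀ x ∈ Icc (0:ℝ) 1, |h₂ x| ≤ M)
    (hδ : ∀ x ∈ Icc (0:ℝ) 1, |z₁ x - z₂ x| ≤ δ)
    (h12 : ∀ x ∈ Icc (0:ℝ) 1, |h₁ x - h₂ x| ≤ ε / 2)
    (hosc : ∀ x ∈ Icc (0:ℝ) 1, ∀ y ∈ Icc (0:ℝ) 1, |x - y| ≤ 1 / N → |h₂ x - h₂ y| ≤ ε / 2)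
    {u : ℝ} (hu : u ∈ Icc (0:ℝ) 1) :
    |(∫ v in Icc 0 u, h₁ v ∂μ₁) - ∫ v in Icc 0 u, h₂ v ∂μ₂|
      ≤ ε * ((z₁ u - z₁ 0) + (z₂ u - z₂ 0)) + 2 * M * δ * N := by
  have hN' : (0:ℝ) < N := Nat.cast_pos.2 hN
  have hM0 : 0 ≤ M := (abs_nonneg _).trans (hM 0 (by simp))
  have hε : 0 ≤ ε := by
    have := (abs_nonneg _).trans (h12 0 (by simp))
    linarith
  have main : ∀ k : ℕ, k ≤ N →
      |(∫ v in Icc 0 (u * (k / N)), h₁ v ∂μ₁) - ∫ v in Icc 0 (u * (k / N)), h₂ v ∂μ₂|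
        ≤ ε * ((z₁ (u * (k / N)) - z₁ 0) + (z₂ (u * (k / N)) - z₂ 0)) + 2 * M * δ * k := by
    intro k
    induction k with
    | zero =>
      intro _
      have e₁ := setIntegral_measure_zero h₁ (hμ₁.measure_singleton le_rfl zero_le_one)
      have e₂ := setIntegral_measure_zero h₂ (hμ₂.measure_singleton le_rfl zero_le_one)
      simp only [Nat.cast_zero, zero_div, mul_zero, Icc_self, sub_self, add_zero]
      rw [e₁, e₂]
      simp
    | succ k ih =>
      intro hk
      have ih := ih (by omega)
      have hk' : (k:ℝ) + 1 ≤ N := by exact_mod_cast hk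
      have hba : u * (((k + 1 : ℕ) : ℝ) / N) = u * (k / N) + u * (1 / N) := by
        push_cast
        ring
      have hb1 : u * (((k + 1 : ℕ) : ℝ) / N) ≤ 1 := by
        refine mul_le_one₀ hu.2 (by positivity) ?_
        rw [div_le_one hN']
        exact_mod_cast hk
      have ha0 : 0 ≤ u * ((k:ℝ) / N) := mul_nonneg hu.1 (by positivity)
      have hstep : u * (1 / N) ≤ 1 / N := mul_le_of_le_one_left (by positivity) hu.2
      have hstep0 : 0 ≤ u * (1 / (N:ℝ)) := mul_nonneg hu.1 (by positivity)
      generalize u * ((k:ℝ) / N) = a at *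
      generalize u * (((k + 1 : ℕ) : ℝ) / N) = b at *
      have hab : a ≤ b := by linarith
      have haI : a ∈ Icc (0:ℝ) 1 := ⟨ha0, hab.trans hb1⟩
      have hbI : b ∈ Icc (0:ℝ) 1 := ⟨ha0.trans hab, hb1⟩
      have hc₂ : ∀ x ∈ Icc a b, |h₂ x - h₂ a| ≤ ε / 2 := fun x hx =>
        hosc x ⟨ha0.trans hx.1, hx.2.trans hb1⟩ a haI <| by
          rw [abs_of_nonneg (sub_nonneg.2 hx.1)]
          linarith [hx.2]
      have hc₁ : ∀ x ∈ Icc a b, |h₁ x - h₂ a| ≤ ε := fun x hx => by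
        linarith [abs_sub_le (h₁ x) (h₂ x) (h₂ a), hc₂ x hx,
          h12 x ⟨ha0.trans hx.1, hx.2.trans hb1⟩]
      have i₁ := hμ₁.abs_integral_increment_sub_le hz₁ hh₁ ha0 hab hb1 hc₁
      have i₂ := hμ₂.abs_integral_increment_sub_le hz₂ hh₂ ha0 hab hb1
        fun x hx => (hc₂ x hx).trans (half_le_self hε)
      have i₃ : |h₂ a * ((z₁ b - z₂ b) - (z₁ a - z₂ a))| ≤ M * (2 * δ) := by
        rw [abs_mul]
        refine mul_le_mul (hM a haI) ?_ (abs_nonneg _) hM0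
        linarith [abs_sub (z₁ b - z₂ b) (z₁ a - z₂ a), hδ a haI, hδ b hbI]
      push_cast
      rw [abs_le] at *
      constructor <;> linarith
  have := main N le_rfl
  rwa [div_self hN'.ne', mul_one] at this

/-- if `gⁿ → g` and `zⁿ → z` uniformly on `[0,1]` (with `zⁿ, z` continuous
non-decreasing), then `sup_{u∈[0,1]} |∫₀ᵘ gⁿ dzⁿ − ∫₀ᵘ g dz| → 0`. -/
theorem stmt10 (g : ℕ → ℝ → ℝ) (g' : ℝ → ℝ) (z : ℕ → ℝ → ℝ) (z' : ℝ → ℝ)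
    (hg_cont : ∀ n, ContinuousOn (g n) (Set.Icc 0 1)) (hg'_cont : ContinuousOn g' (Set.Icc 0 1))
    (hz_cont : ∀ n, ContinuousOn (z n) (Set.Icc 0 1)) (hz'_cont : ContinuousOn z' (Set.Icc 0 1))
    (hz_mono : ∀ n, MonotoneOn (z n) (Set.Icc 0 1)) (hz'_mono : MonotoneOn z' (Set.Icc 0 1))
    (hgconv : TendstoUniformlyOn g g' atTop (Set.Icc 0 1))
    (hzconv : TendstoUniformlyOn z z' atTop (Set.Icc 0 1))
    (μ : ℕ → Measure ℝ) (hμ : ∀ n, IsLSMeasureOn01 (z n) (μ n))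
    (μ' : Measure ℝ) (hμ' : IsLSMeasureOn01 z' μ') :
    TendstoUniformlyOn (fun n u => ∫ v in Set.Icc (0:ℝ) u, g n v ∂(μ n))
      (fun u => ∫ v in Set.Icc (0:ℝ) u, g' v ∂μ') atTop (Set.Icc 0 1) := by
  rw [Metric.tendstoUniformlyOn_iff] at *
  intro e he
  obtain ⟨M, hM⟩ := isCompact_Icc.exists_bound_of_continuousOn hg'_cont
  have hM0 : 0 ≤ M := (norm_nonneg _).trans (hM 0 (by simp))
  have hC : z' 0 ≤ z' 1 := hz'_mono (by simp) (by simp) zero_le_one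
  set K : ℝ := 2 * (z' 1 - z' 0) + 2 with hK
  have hK0 : 0 < K := by linarith
  set ε : ℝ := e / (3 * K) with hε
  have hε0 : 0 < ε := by positivity
  have hεK : ε * K = e / 3 := by
    rw [hε]
    field_simp
  obtain ⟨d, hd, hosc⟩ := Metric.uniformContinuousOn_iff.1
    (isCompact_Icc.uniformContinuousOn_of_continuous hg'_cont) (ε / 2) (half_pos hε0)
  obtain ⟨N, hN⟩ := exists_nat_one_div_lt hd
  set δ : ℝ := min 1 (e / (3 * (2 * M * (N + 1) + 1))) with hδ
  have hδ0 : 0 < δ := by positivity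
  have hδ1 : δ ≤ 1 := min_le_left _ _
  have hδe : 2 * M * δ * (N + 1) ≤ e / 3 := by
    have h := min_le_right 1 (e / (3 * (2 * M * (N + 1) + 1)))
    rw [← hδ, le_div_iff₀ (by positivity)] at h
    linarith
  filter_upwards [hgconv (ε / 2) (half_pos hε0), hzconv δ hδ0] with n hgn hzn u hu
  have hz : ∀ x ∈ Icc (0:ℝ) 1, |z n x - z' x| ≤ δ := fun x hx => by
    rw [← Real.dist_eq, dist_comm]
    exact (hzn x hx).le
  have key := (hμ n).abs_integral_sub_integral_le hμ' (hz_mono n) hz'_mono (hg_cont n) hg'_cont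
    (ε := ε) (Nat.succ_pos N) hM hz
    (fun x hx => by
      rw [← Real.dist_eq, dist_comm]
      exact (hgn x hx).le)
    (fun x hx y hy hxy => (hosc x hx y hy (lt_of_le_of_lt hxy (by exact_mod_cast hN))).le) hu
  have hvar : (z n u - z n 0) + (z' u - z' 0) ≤ K := by
    have h₁ := hz'_mono hu (by simp) hu.2
    have h₂ := (abs_le.1 (hz u hu)).2
    have h₃ := (abs_le.1 (hz 0 (by simp))).1
    linarith
  have := mul_le_mul_of_nonneg_left hvar hε0.le
  push_cast at key
  rw [dist_comm, Real.dist_eq]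
  linarith
end
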